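/- Let A be a finite central arrangement in an ℓ-dimensional Euclidean space V, m : A → ℤ an arbitrary multiplicity, and Q^m := ∏_{H∈A} α_H^{m(H)} ∈ F. If ω₁, …, ω_ℓ ∈ Ω(A,m), then the ℓ-form Q^m (ω₁ ∧ ⋯ ∧ ω_ℓ) is regular (i.e. has polynomial coefficients). -/

import Mathlib

open MvPolynomial

noncomputable section CoxeterFormalization

/-! ### The ambient rings: `S = Sym(V*)`, `F = Frac(S)`, rational 1-forms.

We model the `ℓ`-dimensional Euclidean space `V` as `ℝ^ℓ` with its standard
(orthonormal) coordinates, so that `S = ℝ[x_0, …, x_{ℓ-1}]`, and a rational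
differential 1-form `ω = Σ ω_x dx_x` (equivalently, a rational derivation
`ξ = Σ ξ_x ∂_x`) is recorded by its component vector `(ω_x)_x : Fin ℓ → F`. -/

abbrev Spoly (ℓ : ℕ) := MvPolynomial (Fin ℓ) ℝ
abbrev Ffield (ℓ : ℕ) := FractionRing (Spoly ℓ)
abbrev OmF (ℓ : ℕ) := Fin ℓ → Ffield ℓ

variable {ℓ t : ℕ}

/-- The image of `S` in `F`: the "regular" (polynomial) rational functions. -/
def Sreg (ℓ : ℕ) : Set (Ffield ℓ) := Set.range (algebraMap (Spoly ℓ) (Ffield ℓ))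

def toF (p : Spoly ℓ) : Ffield ℓ := algebraMap (Spoly ℓ) (Ffield ℓ) p

/-- The linear form `α = Σ a_x · x_x ∈ V*` attached to a normal vector `a`. -/
def linForm (a : Fin ℓ → ℝ) : Spoly ℓ := ∑ x, MvPolynomial.C (a x) * MvPolynomial.X x

def linF (a : Fin ℓ → ℝ) : Ffield ℓ := toF (linForm a)

def cF (r : ℝ) : Ffield ℓ := toF (MvPolynomial.C r)

def XF (x : Fin ℓ) : Ffield ℓ := toF (MvPolynomial.X x)

/-- `Q = ∏_{H ∈ A} α_H`, as an element of `F`. -/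
def QF (A : Finset (Fin ℓ → ℝ)) : Ffield ℓ := toF (∏ a ∈ A, linForm a)

/-- `Q^m = ∏_{H ∈ A} α_H^{m(H)}` for an integral multiplicity `m`. -/
def QmF (A : Finset (Fin ℓ → ℝ)) (m : (Fin ℓ → ℝ) → ℤ) : Ffield ℓ :=
  ∏ a ∈ A, linF a ^ m a

/-- Ziegler's module `Ω(A,∞)` of logarithmic 1-forms:
`Q^N ω` and `(Q/α_H)^N dα_H ∧ ω` regular for `N ≫ 0`.  The wedge
`dα_H ∧ ω` is recorded by its components `a_x ω_y - a_y ω_x`. -/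
def OmegaInf (A : Finset (Fin ℓ → ℝ)) : Set (OmF ℓ) :=
  {ω | ∃ N : ℕ,
    (∀ x, QF A ^ N * ω x ∈ Sreg ℓ) ∧
    ∀ a ∈ A, ∀ x y,
      (QF A / linF a) ^ N * (cF (a x) * ω y - cF (a y) * ω x) ∈ Sreg ℓ}

/-- `Ω(A,m)` for an arbitrary multiplicity `m : A → ℤ`: those `ω ∈ Ω(A,∞)` with
`(Q/α_H)^N α_H^{m(H)} I*(dα_H, ω) ∈ S` for `N ≫ 0`; here
`I*(dα_H, ω) = Σ_x a_x ω_x` (the coordinates are orthonormal). -/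
def OmegaMult (A : Finset (Fin ℓ → ℝ)) (m : (Fin ℓ → ℝ) → ℤ) : Set (OmF ℓ) :=
  {ω ∈ OmegaInf A | ∃ N : ℕ,
    ∀ a ∈ A, (QF A / linF a) ^ N * linF a ^ m a * (∑ x, cF (a x) * ω x) ∈ Sreg ℓ}

/-! ### The action of `GL_ℓ(ℝ)` on `S`, `F` and on component vectors. -/

/-- Substitution `x_i ↦ Σ_j M_{i j} x_j`, i.e. `f ↦ f ∘ M`. -/
def matSub (M : Matrix (Fin ℓ) (Fin ℓ) ℝ) : Spoly ℓ →ₐ[ℝ] Spoly ℓ :=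
  MvPolynomial.aeval fun x => ∑ y, MvPolynomial.C (M x y) * MvPolynomial.X y

lemma matSub_comp (M N : Matrix (Fin ℓ) (Fin ℓ) ℝ) :
    (matSub M).comp (matSub N) = matSub (N * M) := by
  apply MvPolynomial.algHom_ext
  intro x
  simp only [matSub, AlgHom.coe_comp, Function.comp_apply, aeval_X, map_sum, map_mul, aeval_C,
    Matrix.mul_apply, C_mul, Finset.sum_mul, Finset.mul_sum, MvPolynomial.algebraMap_eq,
    mul_assoc]
  rw [Finset.sum_comm]

lemma matSub_one : matSub (1 : Matrix (Fin ℓ) (Fin ℓ) ℝ) = AlgHom.id ℝ (Spoly ℓ) := by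
  apply MvPolynomial.algHom_ext
  intro x
  simp [matSub, Matrix.one_apply, apply_ite MvPolynomial.C, ite_mul, Finset.sum_ite_eq]

lemma matSub_injective (g : Matrix.GeneralLinearGroup (Fin ℓ) ℝ) :
    Function.Injective (matSub (↑g : Matrix (Fin ℓ) (Fin ℓ) ℝ)) := by
  intro p q h
  have h3 : (matSub (↑g⁻¹ : Matrix (Fin ℓ) (Fin ℓ) ℝ)).comp
      (matSub (↑g : Matrix (Fin ℓ) (Fin ℓ) ℝ)) = AlgHom.id ℝ (Spoly ℓ) := by
    rw [matSub_comp]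
    have h1 : ((↑g : Matrix (Fin ℓ) (Fin ℓ) ℝ) * (↑g⁻¹ : Matrix (Fin ℓ) (Fin ℓ) ℝ))
        = (1 : Matrix (Fin ℓ) (Fin ℓ) ℝ) := by
      rw [← Units.val_mul]; simp
    rw [h1, matSub_one]
  have h2 := congrArg (matSub (↑g⁻¹ : Matrix (Fin ℓ) (Fin ℓ) ℝ)) h
  rwa [← AlgHom.comp_apply, ← AlgHom.comp_apply, h3, AlgHom.id_apply, AlgHom.id_apply] at h2

/-- The action of `g ∈ GL_ℓ(ℝ)` on rational functions, `f ↦ f ∘ g⁻¹`. -/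
def fAct (g : Matrix.GeneralLinearGroup (Fin ℓ) ℝ) : Ffield ℓ →+* Ffield ℓ :=
  IsFractionRing.lift (g :=
    (algebraMap (Spoly ℓ) (Ffield ℓ)).comp
      (matSub (↑g⁻¹ : Matrix (Fin ℓ) (Fin ℓ) ℝ)).toRingHom)
    ((IsFractionRing.injective (Spoly ℓ) (Ffield ℓ)).comp (matSub_injective g⁻¹))

/-- The natural action of an **orthogonal** `g` on the component vector of a
differential 1-form (equivalently, of a derivation): `(g·v)_x = Σ_y g_{x y} · g(v_y)`. -/
def vecAct (g : Matrix.GeneralLinearGroup (Fin ℓ) ℝ) (v : OmF ℓ) : OmF ℓ :=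
  fun x => ∑ y, cF ((↑g : Matrix (Fin ℓ) (Fin ℓ) ℝ) x y) * fAct g (v y)

/-- `W`-invariant component vectors (1-forms/derivations). -/
def InvVec (W : Subgroup (Matrix.GeneralLinearGroup (Fin ℓ) ℝ)) : Set (OmF ℓ) :=
  {ω | ∀ g ∈ W, vecAct g ω = ω}

/-- `Ω(A,∞)^W`. -/
def OmegaInfW (A : Finset (Fin ℓ → ℝ)) (W : Subgroup (Matrix.GeneralLinearGroup (Fin ℓ) ℝ)) :
    Set (OmF ℓ) := OmegaInf A ∩ InvVec W

/-- `Ω(A,m)^W = Ω(A,m) ∩ Ω(A,∞)^W`. -/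
def OmegaMultW (A : Finset (Fin ℓ → ℝ)) (W : Subgroup (Matrix.GeneralLinearGroup (Fin ℓ) ℝ))
    (m : (Fin ℓ → ℝ) → ℤ) : Set (OmF ℓ) := OmegaMult A m ∩ InvVec W

/-- `W`-invariant polynomials. -/
def InvPoly (W : Subgroup (Matrix.GeneralLinearGroup (Fin ℓ) ℝ)) : Set (Spoly ℓ) :=
  {p | ∀ g ∈ W, matSub (↑g : Matrix (Fin ℓ) (Fin ℓ) ℝ) p = p}

/-- The invariant ring `R = S^W`, viewed inside `F`. -/
def RF (W : Subgroup (Matrix.GeneralLinearGroup (Fin ℓ) ℝ)) : Set (Ffield ℓ) :=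
  toF '' InvPoly W

/-- The orthogonal reflection through the hyperplane `ker⟨a, ·⟩`. -/
def reflMat (a : Fin ℓ → ℝ) : Matrix (Fin ℓ) (Fin ℓ) ℝ :=
  1 - (2 / ∑ x, a x * a x) • Matrix.vecMulVec a a

/-! ### Block (irreducible-factor) structure. -/

/-- A polynomial involving only the variables of the block `i` (w.r.t. the block
assignment `blk : Fin ℓ → Fin t`). -/
def blockPoly (blk : Fin ℓ → Fin t) (i : Fin t) (p : Spoly ℓ) : Prop :=
  ∀ m ∈ p.support, ∀ x ∈ Finsupp.support m, blk x = i

/-- Rational functions in the variables of block `i` only. -/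
def blockFrac (blk : Fin ℓ → Fin t) (i : Fin t) : Set (Ffield ℓ) :=
  {y | ∃ p q : Spoly ℓ, blockPoly blk i p ∧ blockPoly blk i q ∧ q ≠ 0 ∧ y * toF q = toF p}

/-- A component vector belonging to the factor `V[i]`:  components outside block `i`
vanish and all components are rational functions of the block-`i` variables. -/
def BlockVec (blk : Fin ℓ → Fin t) (i : Fin t) (ω : OmF ℓ) : Prop :=
  (∀ x, blk x ≠ i → ω x = 0) ∧ ∀ x, ω x ∈ blockFrac blk i

/-- All the data of a (not necessarily irreducible) Coxeter arrangement `A` in the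
Euclidean space `V = ℝ^ℓ`, together with its decomposition into `t` irreducible
factors and a system of basic invariants:

* `A` is a finite set of hyperplanes, recorded by nonzero defining normal vectors,
  pairwise non-proportional;
* `W` is a finite subgroup of `GL_ℓ(ℝ)` consisting of orthogonal transformations,
  generated by the reflections through the members of `A`, and `A` is exactly the
  set of reflecting hyperplanes of `W` (so `A` is the Coxeter arrangement of the
  finite real reflection group `W`);
* `blk` assigns to every coordinate its irreducible block `V[i]`, every hyperplane
  of `A` lies over a single block;
* `P c` (`c : Fin ℓ`) are basic invariants: homogeneous, `W`-invariant,
  algebraically independent generators of `R = S^W`, the invariants of the block `i`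
  being those `P c` with `blk c = i` and involving only block-`i` variables;
* within each block `i` the invariant `P (top i)` has strictly largest degree
  (this uses irreducibility of the factors; it makes the primitive derivations
  `D[i] = ∂/∂P_{ℓ[i]}[i]` well defined up to constants). -/
structure CoxeterSetup (ℓ t : ℕ) where
  A : Finset (Fin ℓ → ℝ)
  W : Subgroup (Matrix.GeneralLinearGroup (Fin ℓ) ℝ)
  hA0 : ∀ a ∈ A, a ≠ 0
  hAprop : ∀ a ∈ A, ∀ b ∈ A, (∃ c : ℝ, a = c • b) → a = b
  hWfin : (W : Set (Matrix.GeneralLinearGroup (Fin ℓ) ℝ)).Finite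
  hWorth : ∀ g ∈ W, Matrix.transpose (↑g : Matrix (Fin ℓ) (Fin ℓ) ℝ) * (↑g : Matrix (Fin ℓ) (Fin ℓ) ℝ) = 1
  hrefl : ∀ a ∈ A, ∃ g ∈ W, (↑g : Matrix (Fin ℓ) (Fin ℓ) ℝ) = reflMat a
  hhyp : ∀ g ∈ W, ∀ a : Fin ℓ → ℝ, a ≠ 0 → (↑g : Matrix (Fin ℓ) (Fin ℓ) ℝ) = reflMat a →
    ∃ b ∈ A, ∃ c : ℝ, a = c • b
  hgen : W = Subgroup.closure
    {g : Matrix.GeneralLinearGroup (Fin ℓ) ℝ | ∃ a ∈ A, (↑g : Matrix (Fin ℓ) (Fin ℓ) ℝ) = reflMat a}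
  blk : Fin ℓ → Fin t
  hblkA : ∀ a ∈ A, ∃ i, ∀ x, a x ≠ 0 → blk x = i
  P : Fin ℓ → MvPolynomial (Fin ℓ) ℝ
  deg : Fin ℓ → ℕ
  hdeg : ∀ c, 0 < deg c
  hPhom : ∀ c, (P c).IsHomogeneous (deg c)
  hPblock : ∀ c, blockPoly blk (blk c) (P c)
  hPinv : ∀ c, P c ∈ InvPoly W
  hPind : AlgebraicIndependent ℝ P
  hPgen : ∀ p : Spoly ℓ, p ∈ InvPoly W ↔ p ∈ Algebra.adjoin ℝ (Set.range P)
  top : Fin t → Fin ℓ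
  htop : ∀ i, blk (top i) = i
  htopdeg : ∀ i c, blk c = i → c ≠ top i → deg c < deg (top i)

/-! ### Primitive derivations and the connection `∇_D`. -/

/-- The covariant derivative `∇_D` on rational 1-forms: since `∇_D (dx_x) = 0`,
it acts componentwise, `∇_D(Σ f_x dx_x) = Σ D(f_x) dx_x`. -/
def nabVec (D : Derivation ℝ (Ffield ℓ) (Ffield ℓ)) (ω : OmF ℓ) : OmF ℓ :=
  fun x => D (ω x)

/-- `T = ker (D : R → R)`, viewed inside `F`. -/
def TF (W : Subgroup (Matrix.GeneralLinearGroup (Fin ℓ) ℝ))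
    (D : Derivation ℝ (Ffield ℓ) (Ffield ℓ)) : Set (Ffield ℓ) :=
  {y ∈ RF W | D y = 0}

/-- The differential `dP` of a polynomial, as a component vector: `(dP)_x = ∂P/∂x_x`. -/
def dPoly (p : Spoly ℓ) : OmF ℓ := fun x => toF (MvPolynomial.pderiv x p)

/-! ### Freeness of a submodule over a subring of coefficients. -/

/-- `v : ι → M` is a basis of the sub-`C`-module `Mod ⊆ M` over the coefficient
set `C ⊆ F`: the members of the family lie in `Mod`, every element of `Mod`
is a finite `C`-linear combination of them, and they are linearly independent
over `C`. -/
def IsBasisOver {ℓ : ℕ} {ι M : Type*} [AddCommMonoid M] [Module (Ffield ℓ) M]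
    (C : Set (Ffield ℓ)) (Mod : Set M) (v : ι → M) : Prop :=
  (∀ j, v j ∈ Mod) ∧
  (∀ ω ∈ Mod, ∃ c : ι →₀ Ffield ℓ, (∀ j, c j ∈ C) ∧ ω = c.sum fun j a => a • v j) ∧
  (∀ c : ι →₀ Ffield ℓ, (∀ j, c j ∈ C) → (c.sum fun j a => a • v j) = 0 → c = 0)

/-! ### Order of poles along a hyperplane. -/

/-- The localization `S_{(α)}` of `S` at the prime ideal `(α)`, viewed in `F`:
fractions with denominator prime to `α`. -/
def Sloc (a : Fin ℓ → ℝ) : Set (Ffield ℓ) :=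
  {y | ∃ p q : Spoly ℓ, ¬ linForm a ∣ q ∧ y * toF q = toF p}

/-- `ordEq a f k` says `ord_α(f) = k`, i.e. `k = min {j : α^j f ∈ S_{(α)}}`. -/
def ordEq (a : Fin ℓ → ℝ) (f : Ffield ℓ) (k : ℤ) : Prop :=
  linF a ^ k * f ∈ Sloc a ∧ ∀ j : ℤ, linF a ^ j * f ∈ Sloc a → k ≤ j

/-! ### Logarithmic derivation modules. -/

/-- The module `D(A,−∞)` of logarithmic derivations (Definition 4.1):
`Q^N ξ` regular and `(Q/α_H)^N ξ(β)` regular whenever `β ⊥ α_H`. -/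
def DerInf (A : Finset (Fin ℓ → ℝ)) : Set (Derivation ℝ (Ffield ℓ) (Ffield ℓ)) :=
  {ξ | ∃ N : ℕ,
    (∀ x, QF A ^ N * ξ (XF x) ∈ Sreg ℓ) ∧
    ∀ a ∈ A, ∀ b : Fin ℓ → ℝ, (∑ x, a x * b x) = 0 →
      (QF A / linF a) ^ N * ξ (linF b) ∈ Sreg ℓ}

/-- `D(A,m)` for a multiplicity `m : A → ℤ`:
`(Q/α_H)^N ξ(α_H) ∈ α_H^{m(H)} S` for `N ≫ 0`. -/
def DerMult (A : Finset (Fin ℓ → ℝ)) (m : (Fin ℓ → ℝ) → ℤ) :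
    Set (Derivation ℝ (Ffield ℓ) (Ffield ℓ)) :=
  {ξ ∈ DerInf A | ∃ N : ℕ, ∀ a ∈ A, ∃ p : Spoly ℓ,
    (QF A / linF a) ^ N * ξ (linF a) = linF a ^ m a * toF p}

/-- The component vector of a derivation: `ξ = Σ_x ξ(x_x) ∂_x`. -/
def derVec (ξ : Derivation ℝ (Ffield ℓ) (Ffield ℓ)) : OmF ℓ := fun x => ξ (XF x)

/-- `W`-invariant derivations (via the action on component vectors; the group
consists of orthogonal transformations). -/
def InvDer (W : Subgroup (Matrix.GeneralLinearGroup (Fin ℓ) ℝ)) :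
    Set (Derivation ℝ (Ffield ℓ) (Ffield ℓ)) :=
  {ξ | ∀ g ∈ W, vecAct g (derVec ξ) = derVec ξ}

/-- `D(A,−∞)^W`. -/
def DerInfW (A : Finset (Fin ℓ → ℝ)) (W : Subgroup (Matrix.GeneralLinearGroup (Fin ℓ) ℝ)) :
    Set (Derivation ℝ (Ffield ℓ) (Ffield ℓ)) := DerInf A ∩ InvDer W

/-- `D(A,m)^W = D(A,m) ∩ D(A,−∞)^W`. -/
def DerMultW (A : Finset (Fin ℓ → ℝ)) (W : Subgroup (Matrix.GeneralLinearGroup (Fin ℓ) ℝ))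
    (m : (Fin ℓ → ℝ) → ℤ) : Set (Derivation ℝ (Ffield ℓ) (Ffield ℓ)) :=
  DerMult A m ∩ InvDer W

/-- `I* : Ω_F → Der_F`, `I*(ω)(f) = I*(ω, df) = Σ_x ω_x ∂f/∂x_x`, defined using a
family `pd` of partial-derivative derivations of `F`. -/
def IstarDer (pd : Fin ℓ → Derivation ℝ (Ffield ℓ) (Ffield ℓ)) (ω : OmF ℓ) :
    Derivation ℝ (Ffield ℓ) (Ffield ℓ) :=
  ∑ x, ω x • pd x

/-- The covariant derivative `∇_D` on rational derivations: `(∇_D ξ)(α) = D(ξ(α))`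
for `α ∈ V*`, i.e. `∇_D ξ = Σ_x D(ξ(x_x)) ∂_x`. -/
def nabDer (pd : Fin ℓ → Derivation ℝ (Ffield ℓ) (Ffield ℓ))
    (D : Derivation ℝ (Ffield ℓ) (Ffield ℓ))
    (ξ : Derivation ℝ (Ffield ℓ) (Ffield ℓ)) : Derivation ℝ (Ffield ℓ) (Ffield ℓ) :=
  ∑ x, D (ξ (XF x)) • pd x

end CoxeterFormalization

section RegularAway

variable {R K : Type*} [CommRing R] [Field K] [Algebra R K]

/-- The elements of `K` that become integral (lie in the image of `R`) after multiplication by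
some power of `q`. -/
def regularAway (K : Type*) [Field K] [Algebra R K] (q : R) : Subalgebra R K where
  carrier := {x | ∃ N : ℕ, algebraMap R K q ^ N * x ∈ Set.range (algebraMap R K)}
  mul_mem' := by
    rintro x y ⟨M, p, hp⟩ ⟨N, r, hr⟩
    exact ⟨M + N, p * r, by rw [map_mul, hp, hr]; ring⟩
  add_mem' := by
    rintro x y ⟨M, p, hp⟩ ⟨N, r, hr⟩
    exact ⟨M + N, q ^ N * p + q ^ M * r, by simp only [map_add, map_mul, map_pow, hp, hr]; ring⟩
  algebraMap_mem' p := ⟨0, p, by simp⟩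

lemma inv_algebraMap_mem_regularAway [FaithfulSMul R K] {q p : R} (hp : p ≠ 0) (h : p ∣ q) :
    (algebraMap R K p)⁻¹ ∈ regularAway K q := by
  obtain ⟨r, rfl⟩ := h
  have : algebraMap R K p ≠ 0 := by simpa using hp
  exact ⟨1, r, by rw [map_mul]; field_simp⟩

lemma zpow_algebraMap_mem_regularAway [FaithfulSMul R K] {q p : R} (hp : p ≠ 0) (h : p ∣ q)
    (k : ℤ) : algebraMap R K p ^ k ∈ regularAway K q := by
  cases k with
  | ofNat n => simpa using pow_mem (Subalgebra.algebraMap_mem _ p) n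
  | negSucc n =>
    rw [zpow_negSucc, ← inv_pow]
    exact pow_mem (inv_algebraMap_mem_regularAway hp h) _

lemma Matrix.det_mem_subalgebra {n : Type*} [Fintype n] [DecidableEq n] (T : Subalgebra R K)
    (M : Matrix n n K) (h : ∀ i j, M i j ∈ T) : M.det ∈ T := by
  rw [Matrix.det_apply]
  refine sum_mem fun σ _ => ?_
  rw [Units.smul_def]
  exact zsmul_mem (prod_mem fun i _ => h _ _) _

/-- An element whose denominator only involves the pairwise coprime primes `f i` is integral as
soon as it is integral away from the product of the remaining primes, for each `i`. -/
lemma mem_range_algebraMap_of_regularAway_erase [IsDomain R] [UniqueFactorizationMonoid R]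
    [IsFractionRing R K] {ι : Type*} [DecidableEq ι] (s : Finset ι) (f : ι → R)
    (hf : ∀ i ∈ s, Prime (f i)) (hdvd : ∀ i ∈ s, ∀ j ∈ s, f i ∣ f j → i = j) (x : K)
    (hx : x ∈ regularAway K (∏ i ∈ s, f i))
    (hxi : ∀ i ∈ s, x ∈ regularAway K (∏ j ∈ s.erase i, f j)) :
    x ∈ Set.range (algebraMap R K) := by
  obtain ⟨a, b, hab, rfl⟩ := IsFractionRing.exists_reduced_fraction R x
  have hb0 : (b : R) ≠ 0 := nonZeroDivisors.coe_ne_zero b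
  have key : ∀ q : R, IsLocalization.mk' K a b ∈ regularAway K q → ∃ N : ℕ, (b : R) ∣ q ^ N := by
    rintro q ⟨N, p, hp⟩
    refine ⟨N, hab.symm.dvd_of_dvd_mul_right (z := a) ⟨p, ?_⟩⟩
    apply IsFractionRing.injective R K
    rw [map_mul, map_mul, hp, map_pow, mul_left_comm, IsLocalization.mk'_spec']
  have hunit : IsUnit (b : R) := by
    by_contra hnu
    obtain ⟨π, hπ, hπb⟩ := WfDvdMonoid.exists_irreducible_factor hnu hb0
    have hπ' := hπ.prime
    obtain ⟨N, hN⟩ := key _ hx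
    obtain ⟨i, hi, hπi⟩ := hπ'.exists_mem_finset_dvd (hπ'.dvd_of_dvd_pow (hπb.trans hN))
    have hiπ : f i ∣ π := (hπ.associated_of_dvd (hf i hi).irreducible hπi).symm.dvd
    obtain ⟨M, hM⟩ := key _ (hxi i hi)
    obtain ⟨j, hj, hij⟩ := (hf i hi).exists_mem_finset_dvd
      ((hf i hi).dvd_of_dvd_pow ((hiπ.trans hπb).trans hM))
    exact Finset.ne_of_mem_erase hj (hdvd i hi j (Finset.mem_of_mem_erase hj) hij).symm
  obtain ⟨u, hu⟩ := hunit.exists_right_inv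
  refine ⟨a * u, ?_⟩
  rw [IsLocalization.eq_mk'_iff_mul_eq, ← map_mul]
  congr 1
  linear_combination a * hu

end RegularAway

section LinearForms

variable {ℓ : ℕ}

lemma eval_linForm (a v : Fin ℓ → ℝ) : MvPolynomial.eval v (linForm a) = ∑ x, a x * v x := by
  simp [linForm]

lemma prime_linForm {a : Fin ℓ → ℝ} (ha : a ≠ 0) : Prime (linForm a) := by
  have h : linForm a = MvPolynomial.sumSMulX (Finsupp.equivFunOnFinite.symm a) := by
    rw [MvPolynomial.sumSMulX, Finsupp.linearCombination_apply, Finsupp.sum_fintype _ _ (by simp)]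
    simp [linForm, MvPolynomial.smul_eq_C_mul]
  obtain ⟨x, hx⟩ := Function.ne_iff.mp ha
  rw [h]
  refine (MvPolynomial.irreducible_sumSMulX _ ⟨x, by simpa using hx⟩ fun r hr => ?_).prime
  refine isUnit_iff_ne_zero.mpr ?_
  rintro rfl
  exact hx (by simpa using hr x)

lemma exists_smul_of_linForm_dvd {a b : Fin ℓ → ℝ} (ha : a ≠ 0) (h : linForm a ∣ linForm b) :
    ∃ c : ℝ, b = c • a := by
  obtain ⟨x, hx⟩ := Function.ne_iff.mp ha
  rw [Pi.zero_apply] at hx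
  refine ⟨b x / a x, funext fun y => ?_⟩
  obtain ⟨p, hp⟩ := h
  have := congrArg (MvPolynomial.eval (a x • Pi.single y 1 - a y • Pi.single x 1)) hp
  simp only [map_mul, eval_linForm, Pi.sub_apply, Pi.smul_apply, smul_eq_mul, mul_sub,
    Finset.sum_sub_distrib, Pi.single_apply, mul_ite, mul_one, mul_zero, Finset.sum_ite_eq',
    Finset.mem_univ, if_true] at this
  simp only [Pi.smul_apply, smul_eq_mul]
  field_simp
  linear_combination this

lemma cF_mul (r s : ℝ) : (cF (r * s) : Ffield ℓ) = cF r * cF s := by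
  simp [cF, toF]

lemma cF_ne_zero {r : ℝ} (hr : r ≠ 0) : (cF r : Ffield ℓ) ≠ 0 := by
  simpa [cF, toF] using hr

lemma cF_mem (T : Subalgebra (Spoly ℓ) (Ffield ℓ)) (r : ℝ) : cF r ∈ T :=
  T.algebraMap_mem _

/-- Up to a nonzero constant, `ω₁ ∧ ⋯ ∧ ω_ℓ` is computed from the components `I*(dα, ω_j)` and
the components of `dα ∧ ω_j`; so a factor clearing the denominators of the former clears those of
the `ℓ`-form whenever the latter are already regular. -/
lemma mul_det_mem_of_wedge_mem (T : Subalgebra (Spoly ℓ) (Ffield ℓ)) {a : Fin ℓ → ℝ} (ha : a ≠ 0)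
    (ω : Fin ℓ → OmF ℓ) (c : Ffield ℓ)
    (hwedge : ∀ j x y, cF (a x) * ω j y - cF (a y) * ω j x ∈ T)
    (hpair : ∀ j, c * ∑ x, cF (a x) * ω j x ∈ T) :
    c * (Matrix.of fun x j => ω j x).det ∈ T := by
  obtain ⟨z, hz⟩ := Function.ne_iff.mp ha
  rw [Pi.zero_apply] at hz
  set M : Matrix (Fin ℓ) (Fin ℓ) (Ffield ℓ) := Matrix.of fun x j => ω j x with hM
  set k : Fin ℓ → Ffield ℓ := fun y => if y = z then 0 else - cF (a y / a z) with hk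
  set M' : Matrix (Fin ℓ) (Fin ℓ) (Ffield ℓ) := Matrix.of fun y j => M y j + k y * M z j with hM'
  have hdet : M'.det = M.det :=
    Matrix.det_eq_of_forall_row_eq_smul_add_const k z (by simp [hk]) fun _ _ => rfl
  have hM'mem : ∀ y, y ≠ z → ∀ j, M' y j ∈ T := by
    intro y hy j
    have h : M' y j = cF (a z)⁻¹ * (cF (a z) * ω j y - cF (a y) * ω j z) := by
      have h1 : (cF (a z)⁻¹ : Ffield ℓ) * cF (a z) = 1 := by
        rw [← cF_mul, inv_mul_cancel₀ hz]; simp [cF, toF]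
      simp only [hM', hM, hk, Matrix.of_apply, if_neg hy, div_eq_mul_inv, cF_mul]
      linear_combination -(ω j y) * h1
    rw [h]
    exact T.mul_mem (cF_mem T _) (hwedge j z y)
  -- the coefficients expressing `I*(dα, ·)` through the rows of `M'`
  set s : ℝ := ∑ y, a y * a y with hs
  have hs0 : s ≠ 0 := by
    have : 0 < s := Finset.sum_pos' (fun y _ => mul_self_nonneg _)
      ⟨z, Finset.mem_univ _, mul_self_pos.mpr hz⟩
    exact this.ne'
  set d : Fin ℓ → Ffield ℓ := fun y => if y = z then cF (s / a z) else cF (a y) with hd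
  have hsum : ∑ y, d y • M' y = fun j => ∑ y, cF (a y) * ω j y := by
    funext j
    have hs' : (cF (s / a z) : Ffield ℓ) = ∑ y, cF (a y) * cF (a y / a z) := by
      rw [hs, Finset.sum_div]
      simp only [← cF_mul, mul_div_assoc]
      simp [cF, toF]
    have e1 : (cF (a z / a z) : Ffield ℓ) = 1 := by rw [div_self hz]; simp [cF, toF]
    rw [Finset.sum_apply, ← Finset.add_sum_erase _ _ (Finset.mem_univ z),
      ← Finset.add_sum_erase _ (fun y => cF (a y) * ω j y) (Finset.mem_univ z)]
    rw [← Finset.add_sum_erase _ _ (Finset.mem_univ z)] at hs'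
    have h2 : ∀ y ∈ Finset.univ.erase z, (d y • M' y) j =
        cF (a y) * ω j y - (cF (a y) * cF (a y / a z)) * ω j z := by
      intro y hy
      simp only [hd, hM', hM, hk, Pi.smul_apply, smul_eq_mul, Matrix.of_apply,
        if_neg (Finset.ne_of_mem_erase hy)]
      ring
    rw [Finset.sum_congr rfl h2, Finset.sum_sub_distrib, ← Finset.sum_mul]
    simp only [hd, hM', hM, hk, Pi.smul_apply, smul_eq_mul, Matrix.of_apply, if_true]
    rw [e1] at hs'
    linear_combination ω j z * hs'
  have hrow := Matrix.det_updateRow_sum M' z d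
  rw [hsum, hdet] at hrow
  have hmem : (M'.updateRow z (c • fun j => ∑ y, cF (a y) * ω j y)).det ∈ T := by
    refine Matrix.det_mem_subalgebra T _ fun y j => ?_
    by_cases hy : y = z
    · subst hy
      simpa using hpair j
    · rw [Matrix.updateRow_ne hy]
      exact hM'mem y hy j
  rw [Matrix.det_updateRow_smul, hrow] at hmem
  have hfin : c * M.det = cF (a z / s) * (c * d z • M.det) := by
    have : (cF (a z / s) : Ffield ℓ) * cF (s / a z) = 1 := by
      rw [← cF_mul, div_mul_div_comm, mul_comm s, div_self (mul_ne_zero hz hs0)]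
      simp [cF, toF]
    simp only [hd, if_true, smul_eq_mul]
    linear_combination -(c * M.det) * this
  rw [hfin]
  exact T.mul_mem (cF_mem T _) hmem

lemma QF_div_linF {A : Finset (Fin ℓ → ℝ)} {a : Fin ℓ → ℝ} (ha : a ∈ A) (ha0 : a ≠ 0) :
    QF A / linF a = toF (∏ b ∈ A.erase a, linForm b) := by
  have : (linF a : Ffield ℓ) ≠ 0 := by
    simpa [linF, toF] using (prime_linForm ha0).ne_zero
  rw [div_eq_iff this, QF, ← Finset.prod_erase_mul _ _ ha]
  simp [linF, toF]

end LinearForms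

section Statements

variable {ℓ t : ℕ}

/-- Proposition 2.1 (1): for `ω₁, …, ω_ℓ ∈ Ω(A,m)`, the `ℓ`-form
`Q^m (ω₁ ∧ ⋯ ∧ ω_ℓ)` is regular; the wedge is recorded by its coefficient
`det(ω_j x)` with respect to `dx₁ ∧ ⋯ ∧ dx_ℓ`. -/
theorem stmt2 (A : Finset (Fin ℓ → ℝ))
    (hA0 : ∀ a ∈ A, a ≠ 0)
    (hAprop : ∀ a ∈ A, ∀ b ∈ A, (∃ c : ℝ, a = c • b) → a = b)
    (m : (Fin ℓ → ℝ) → ℤ) (ω : Fin ℓ → OmF ℓ) (hω : ∀ j, ω j ∈ OmegaMult A m) :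
    QmF A m * (Matrix.of fun x j => ω j x).det ∈ Sreg ℓ := by
  have hne : ∀ a ∈ A, linForm a ≠ 0 := fun a ha => (prime_linForm (hA0 a ha)).ne_zero
  refine mem_range_algebraMap_of_regularAway_erase A linForm
    (fun a ha => prime_linForm (hA0 a ha))
    (fun a ha b hb h =>
      (hAprop b hb a ha (exists_smul_of_linForm_dvd (hA0 a ha) h)).symm) _ ?_ fun a ha => ?_
  · refine mul_mem (prod_mem fun a ha =>
      zpow_algebraMap_mem_regularAway (hne a ha) (Finset.dvd_prod_of_mem _ ha) _) ?_
    refine Matrix.det_mem_subalgebra _ _ fun x j => ?_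
    obtain ⟨⟨N, hN, -⟩, -⟩ := hω j
    exact ⟨N, hN x⟩
  · rw [QmF, ← Finset.prod_erase_mul _ _ ha, mul_assoc]
    refine mul_mem (prod_mem fun b hb => zpow_algebraMap_mem_regularAway
      (hne b (Finset.mem_of_mem_erase hb)) (Finset.dvd_prod_of_mem _ hb) _) ?_
    refine mul_det_mem_of_wedge_mem _ (hA0 a ha) ω _ (fun j x y => ?_) fun j => ?_
    · obtain ⟨⟨N, -, hN⟩, -⟩ := hω j
      have h := hN a ha x y
      rw [QF_div_linF ha (hA0 a ha)] at h
      exact ⟨N, h⟩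
    · obtain ⟨-, N, hN⟩ := hω j
      have h := hN a ha
      rw [QF_div_linF ha (hA0 a ha), mul_assoc] at h
      exact ⟨N, h⟩

end Statements
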